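/- arXiv:2604.02474 — 4 statements merged into one kernel-verified Lean document; each statement's English description precedes it below -/
import Mathlib

section
/- Let a ∈ (0,1), N a positive integer, (X_t)_{t=1}^N a finite real input sequence, z_0 an initial condition, and let (z_t)_{t=0}^N be the time lag system z_t = a·z_{t-1} + (1-a)·X_t. Let B > 0 satisfy |X_t| ≤ B for t = 1,…,N and |z_t| ≤ B for t = 0,…,N. Fix δ > 0, define the rescaled sequences z'_t = (δ/B)·z_t and X'_t = (δ/B)·X_t, and define the tanh RNN hidden state by h_0 = z'_0 and h_t = tanh(a·h_{t-1} + (1-a)·X'_t) for t ≥ 1. Then max_{1 ≤ t ≤ N} |z'_t - h_t| ≤ (δ³/3)·(1 - a^N)/(1 - a), and hence the reverse-transformed predictions ẑ_t = (B/δ)·h_t satisfy max_{1 ≤ t ≤ N} |z_t - ẑ_t| ≤ (B·δ²/3)·(1 - a^N)/(1 - a). -/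
theorem Real.hasDerivAt_tanh_one_sub_sq (x : ℝ) :
    HasDerivAt Real.tanh (1 - Real.tanh x ^ 2) x := by
  have hc : Real.cosh x ≠ 0 := (Real.cosh_pos x).ne'
  have hd := (Real.hasDerivAt_sinh x).div (Real.hasDerivAt_cosh x) hc
  have he : Real.tanh = Real.sinh / Real.cosh := funext Real.tanh_eq_sinh_div_cosh
  refine (he ▸ hd).congr_deriv ?_
  rw [Real.tanh_eq_sinh_div_cosh]
  field_simp

theorem Real.monotone_tanh : Monotone Real.tanh :=
  monotone_of_hasDerivAt_nonneg Real.hasDerivAt_tanh_one_sub_sq fun x =>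
    sub_nonneg.2 (Real.tanh_sq_lt_one x).le

theorem Real.monotone_sub_tanh : Monotone fun x => x - Real.tanh x := by
  refine monotone_of_hasDerivAt_nonneg
    (fun x => (hasDerivAt_id x).sub (Real.hasDerivAt_tanh_one_sub_sq x)) fun x => ?_
  simpa using sq_nonneg (Real.tanh x)

theorem Real.abs_tanh_sub_tanh_le (x y : ℝ) : |Real.tanh x - Real.tanh y| ≤ |x - y| := by
  wlog hxy : y ≤ x generalizing x y
  · rw [abs_sub_comm, abs_sub_comm x]
    exact this y x (le_of_not_ge hxy)
  have hsub := Real.monotone_sub_tanh hxy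
  rw [abs_of_nonneg (sub_nonneg.2 (Real.monotone_tanh hxy)), abs_of_nonneg (sub_nonneg.2 hxy)]
  linarith

theorem Real.monotone_cube_div_three_sub_add_tanh :
    Monotone fun x : ℝ => x ^ 3 / 3 - x + Real.tanh x := by
  refine monotone_of_hasDerivAt_nonneg
    (fun x => (((hasDerivAt_pow 3 x).div_const 3).sub (hasDerivAt_id x)).add
      (Real.hasDerivAt_tanh_one_sub_sq x)) fun x => ?_
  have hsq : Real.tanh x ^ 2 ≤ x ^ 2 := by
    simpa using sq_le_sq.2 (Real.abs_tanh_sub_tanh_le x 0)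
  simp only [Pi.zero_apply]
  norm_num
  linarith

theorem Real.abs_sub_tanh_le (x : ℝ) : |x - Real.tanh x| ≤ |x| ^ 3 / 3 := by
  wlog hx : 0 ≤ x generalizing x
  · have hneg := this (-x) (by linarith)
    rwa [Real.tanh_neg, abs_neg, ← neg_sub', abs_neg] at hneg
  have h₁ := Real.monotone_sub_tanh hx
  have h₂ := Real.monotone_cube_div_three_sub_add_tanh hx
  simp only [Real.tanh_zero] at h₁ h₂
  rw [abs_of_nonneg hx, abs_of_nonneg (by linarith)]
  linarith

/-- Error bound for the tanh simple RNN approximating the (rescaled) time lag system: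
`max_{1≤t≤N} |z'_t - h_t| ≤ (δ³/3)(1-a^N)/(1-a)` and the reverse-transformed
predictions `ẑ_t = (B/δ) h_t` satisfy
`max_{1≤t≤N} |z_t - ẑ_t| ≤ (B δ²/3)(1-a^N)/(1-a)`. -/
theorem tanhRNN_error_bound (a : ℝ) (ha : 0 < a) (ha1 : a < 1)
    (N : ℕ) (hN : 0 < N) (X z : ℕ → ℝ)
    (hz : ∀ t : ℕ, z (t + 1) = a * z t + (1 - a) * X (t + 1))
    (B : ℝ) (hB : 0 < B)
    (hXB : ∀ t : ℕ, 1 ≤ t → t ≤ N → |X t| ≤ B)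
    (hzB : ∀ t : ℕ, t ≤ N → |z t| ≤ B)
    (δ : ℝ) (hδ : 0 < δ)
    (z' X' h : ℕ → ℝ)
    (hz' : ∀ t : ℕ, z' t = δ / B * z t)
    (hX' : ∀ t : ℕ, X' t = δ / B * X t)
    (hh0 : h 0 = z' 0)
    (hh : ∀ t : ℕ, h (t + 1) = Real.tanh (a * h t + (1 - a) * X' (t + 1))) :
    (∀ t : ℕ, 1 ≤ t → t ≤ N →
      |z' t - h t| ≤ δ ^ 3 / 3 * ((1 - a ^ N) / (1 - a))) ∧
    (∀ t : ℕ, 1 ≤ t → t ≤ N →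
      |z t - B / δ * h t| ≤ B * δ ^ 2 / 3 * ((1 - a ^ N) / (1 - a))) := by
  have hscale : 0 < δ / B := div_pos hδ hB
  have hz'_le (t : ℕ) (ht : t ≤ N) : |z' t| ≤ δ := by
    rw [hz', abs_mul, abs_of_pos hscale]
    calc δ / B * |z t| ≤ δ / B * B := by gcongr; exact hzB t ht
      _ = δ := div_mul_cancel₀ δ hB.ne'
  have hsum (t : ℕ) (ht : t ≤ N) : |z' t - h t| ≤ δ ^ 3 / 3 * ((1 - a ^ t) / (1 - a)) := by
    induction t with
    | zero => simp [hh0]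
    | succ t ih =>
      have htanh : |z' (t + 1) - Real.tanh (z' (t + 1))| ≤ δ ^ 3 / 3 :=
        (Real.abs_sub_tanh_le _).trans (by gcongr; exact hz'_le _ ht)
      have hlip : |Real.tanh (z' (t + 1)) - h (t + 1)| ≤ a * |z' t - h t| := by
        rw [hh]
        refine (Real.abs_tanh_sub_tanh_le _ _).trans_eq ?_
        rw [← abs_of_pos ha, ← abs_mul, abs_of_pos ha, hz', hz', hX', hz]
        ring_nf
      calc |z' (t + 1) - h (t + 1)|
          ≤ |z' (t + 1) - Real.tanh (z' (t + 1))| + |Real.tanh (z' (t + 1)) - h (t + 1)| :=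
            abs_sub_le _ _ _
        _ ≤ δ ^ 3 / 3 + a * (δ ^ 3 / 3 * ((1 - a ^ t) / (1 - a))) := by
            gcongr
            exact hlip.trans (by gcongr; exact ih (by lia))
        _ = δ ^ 3 / 3 * ((1 - a ^ (t + 1)) / (1 - a)) := by
            have : 1 - a ≠ 0 := (sub_pos.2 ha1).ne'
            field_simp
            ring
  have hbound (t : ℕ) (ht : t ≤ N) : |z' t - h t| ≤ δ ^ 3 / 3 * ((1 - a ^ N) / (1 - a)) := by
    have hpow : a ^ N ≤ a ^ t := pow_le_pow_of_le_one ha.le ha1.le ht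
    have : 0 < 1 - a := sub_pos.2 ha1
    exact (hsum t ht).trans (by gcongr)
  refine ⟨fun t _ ht => hbound t ht, fun t _ ht => ?_⟩
  have hinv : z t - B / δ * h t = B / δ * (z' t - h t) := by
    rw [hz']
    field_simp
  rw [hinv, abs_mul, abs_of_pos (div_pos hB hδ)]
  calc B / δ * |z' t - h t| ≤ B / δ * (δ ^ 3 / 3 * ((1 - a ^ N) / (1 - a))) := by
        gcongr
        exact hbound t ht
    _ = B * δ ^ 2 / 3 * ((1 - a ^ N) / (1 - a)) := by
        have : 1 - a ≠ 0 := (sub_pos.2 ha1).ne'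
        field_simp
end

section
/- For any ε > 0, any positive integer N, any finite real input sequence (X_t)_{t=1}^N, any initial condition z_0, and any parameter a ∈ (0,1), there exist δ > 0 and B > 0 such that the simple RNN with tanh activation, recurrent weight a, input weight 1-a, zero bias, rescaled inputs X'_t = (δ/B)·X_t, and initial hidden state h_0 = (δ/B)·z_0 produces hidden states (h_t)_{t=1}^N whose reverse-transformed values ẑ_t = (B/δ)·h_t satisfy max_{1 ≤ t ≤ N} |z_t - ẑ_t| < ε, where (z_t)_{t=0}^N is the time lag system z_t = a·z_{t-1} + (1-a)·X_t. -/
/-- If `u` vanishes at the origin then `tanh ∘ u` has the same derivative there as `u`. -/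
theorem HasDerivAt.tanh_of_apply_zero {u : ℝ → ℝ} {L : ℝ} (hu : HasDerivAt u L 0)
    (h0 : u 0 = 0) : HasDerivAt (fun c => Real.tanh (u c)) L 0 := by
  have h := hu.sinh.fun_div hu.cosh (Real.cosh_pos (u 0)).ne'
  simpa [h0, Real.tanh_eq_sinh_div_cosh] using h

/-- The hidden states of the simple tanh RNN with inputs and initial state scaled by `c`. -/
noncomputable def tanhRNNState (a z₀ : ℝ) (X : ℕ → ℝ) (c : ℝ) : ℕ → ℝ
  | 0 => c * z₀
  | t + 1 => Real.tanh (a * tanhRNNState a z₀ X c t + (1 - a) * (c * X (t + 1)))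

theorem tanhRNNState_zero_scale (a z₀ : ℝ) (X : ℕ → ℝ) (t : ℕ) :
    tanhRNNState a z₀ X 0 t = 0 := by
  induction t with
  | zero => simp [tanhRNNState]
  | succ t ih => simp [tanhRNNState, ih]

/-- The time lag system is the derivative of the tanh RNN in the scaling parameter at zero. -/
theorem hasDerivAt_tanhRNNState {a : ℝ} {X z : ℕ → ℝ}
    (hz : ∀ t : ℕ, z (t + 1) = a * z t + (1 - a) * X (t + 1)) (t : ℕ) :
    HasDerivAt (fun c => tanhRNNState a (z 0) X c t) (z t) 0 := by
  induction t with
  | zero => simpa [tanhRNNState] using (hasDerivAt_id (0 : ℝ)).mul_const (z 0)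
  | succ t ih =>
    have hX := ((hasDerivAt_id (0 : ℝ)).mul_const (X (t + 1))).const_mul (1 - a)
    have h := HasDerivAt.tanh_of_apply_zero ((ih.const_mul a).add hX)
      (by simp [tanhRNNState_zero_scale])
    rw [hz]
    simpa [tanhRNNState] using h

open scoped Topology in
/-- A simple RNN with tanh activation can approximate the time lag system with
any desired accuracy on a finite sequence: for any `ε > 0` there are `δ, B > 0`
such that the reverse-transformed hidden states satisfy
`max_{1≤t≤N} |z_t - (B/δ) h_t| < ε`. -/
theorem tanhRNN_approximates_timelag (ε : ℝ) (hε : 0 < ε)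
    (N : ℕ) (hN : 0 < N) (X : ℕ → ℝ) (z : ℕ → ℝ)
    (a : ℝ) (ha : 0 < a) (ha1 : a < 1)
    (hz : ∀ t : ℕ, z (t + 1) = a * z t + (1 - a) * X (t + 1)) :
    ∃ δ B : ℝ, 0 < δ ∧ 0 < B ∧
      ∀ h : ℕ → ℝ, h 0 = δ / B * z 0 →
        (∀ t : ℕ, h (t + 1) = Real.tanh (a * h t + (1 - a) * (δ / B * X (t + 1)))) →
        ∀ t : ℕ, 1 ≤ t → t ≤ N → |z t - B / δ * h t| < ε := by
  have hclose : ∀ t : ℕ, ∀ᶠ c in 𝓝[>] (0 : ℝ), |z t - c⁻¹ * tanhRNNState a (z 0) X c t| < ε := by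
    intro t
    have hlim := (hasDerivAt_tanhRNNState hz t).tendsto_slope_zero_right
    simp only [zero_add, tanhRNNState_zero_scale, sub_zero, smul_eq_mul] at hlim
    filter_upwards [Metric.tendsto_nhds.1 hlim ε hε] with c hc
    rwa [dist_comm, Real.dist_eq] at hc
  have hall := (Set.finite_Iic N).eventually_all.2 fun t _ => hclose t
  obtain ⟨c, hc, hc0⟩ := (hall.and self_mem_nhdsWithin).exists
  refine ⟨c, 1, hc0, one_pos, fun h h0 hrec t _ htN => ?_⟩
  have hstate : ∀ s, h s = tanhRNNState a (z 0) X c s := by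
    intro s
    induction s with
    | zero => simpa [tanhRNNState] using h0
    | succ s ih => simp [hrec, ih, tanhRNNState]
  simpa [hstate] using hc t htN
end

section
/- Let a ∈ (0,1), N a positive integer, (X_t)_{t=1}^N a finite real input sequence, z_0 an initial condition, ε > 0, and let M > 0 satisfy |X_t| ≤ M for t = 1,…,N and |z_0| ≤ M, with ε < M. Let (z_t)_{t=0}^N be the time lag system z_t = a·z_{t-1} + (1-a)·X_t. Choose an output gate bias b_o > logit(1 - ε/M) and set o = σ(b_o), so that 1 - ε/M < o < 1. Define the LSTM-with-linear-activation recursion c_0 = z_0, c_t = a·c_{t-1} + (1-a)·X_t, and h_t = o·c_t for t ≥ 1. Then c_t = z_t for all t = 0,…,N, |z_t| ≤ M for all t, and max_{1 ≤ t ≤ N} |z_t - h_t| < ε. -/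
/-- The sigmoid function `σ(x) = 1/(1+e^{-x})`. -/
noncomputable def sigmoid (x : ℝ) : ℝ := 1 / (1 + Real.exp (-x))

/-- The logit function, inverse of the sigmoid on `(0,1)`: `logit x = ln(x/(1-x))`. -/
noncomputable def logit (x : ℝ) : ℝ := Real.log (x / (1 - x))

theorem sigmoid_lt_one (x : ℝ) : sigmoid x < 1 := by
  have := Real.exp_pos (-x)
  rw [sigmoid, div_lt_one (by positivity)]
  linarith

theorem lt_sigmoid_of_logit_lt {p x : ℝ} (hp : 0 < p) (hp1 : p < 1) (hx : logit p < x) :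
    p < sigmoid x := by
  have hq : 0 < 1 - p := sub_pos.2 hp1
  have hlt : p / (1 - p) < Real.exp x := (Real.log_lt_iff_lt_exp (div_pos hp hq)).1 hx
  rw [div_lt_iff₀ hq] at hlt
  have he := Real.exp_pos (-x)
  have hmul : Real.exp (-x) * Real.exp x = 1 := by rw [← Real.exp_add]; simp
  have key : Real.exp (-x) * p < 1 - p := by
    calc Real.exp (-x) * p < Real.exp (-x) * (Real.exp x * (1 - p)) := by gcongr
      _ = 1 - p := by rw [← mul_assoc, hmul, one_mul]
  rw [sigmoid, lt_div_iff₀ (by positivity)]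
  linarith

/-- An LSTM with one unit and linear activation, constant forget gate `a`,
constant input gate `1-a`, candidate memory `X_t`, and constant output gate
`o = σ(b_o)` with `b_o > logit(1 - ε/M)` approximates the time lag system:
the cell state equals `z_t`, `|z_t| ≤ M`, and `max_{1≤t≤N} |z_t - h_t| < ε`. -/
theorem lstm_linear_approx (a : ℝ) (ha : 0 < a) (ha1 : a < 1)
    (N : ℕ) (hN : 0 < N) (X z : ℕ → ℝ) (ε M : ℝ) (hε : 0 < ε) (hM : 0 < M)
    (hXM : ∀ t : ℕ, 1 ≤ t → t ≤ N → |X t| ≤ M)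
    (hz0M : |z 0| ≤ M) (hεM : ε < M)
    (hz : ∀ t : ℕ, z (t + 1) = a * z t + (1 - a) * X (t + 1))
    (bo o : ℝ) (hbo : bo > logit (1 - ε / M)) (ho : o = sigmoid bo)
    (c h : ℕ → ℝ)
    (hc0 : c 0 = z 0)
    (hc : ∀ t : ℕ, c (t + 1) = a * c t + (1 - a) * X (t + 1))
    (hh : ∀ t : ℕ, h t = o * c t) :
    (∀ t : ℕ, t ≤ N → c t = z t) ∧
    (∀ t : ℕ, t ≤ N → |z t| ≤ M) ∧
    (∀ t : ℕ, 1 ≤ t → t ≤ N → |z t - h t| < ε) := by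
  have hcz : ∀ t : ℕ, c t = z t := by
    intro t
    induction t with
    | zero => exact hc0
    | succ t ih => rw [hc, hz, ih]
  have hzM : ∀ t : ℕ, t ≤ N → |z t| ≤ M := by
    intro t
    induction t with
    | zero => exact fun _ => hz0M
    | succ t ih =>
      intro ht
      obtain ⟨hzl, hzu⟩ := abs_le.1 (ih (by omega))
      obtain ⟨hXl, hXu⟩ := abs_le.1 (hXM (t + 1) (by omega) ht)
      rw [hz, abs_le]
      constructor <;> nlinarith
  have hp : 0 < 1 - ε / M := sub_pos.2 ((div_lt_one hM).2 hεM)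
  have hp1 : 1 - ε / M < 1 := sub_lt_self 1 (div_pos hε hM)
  have hlo : 1 - ε / M < o := ho ▸ lt_sigmoid_of_logit_lt hp hp1 hbo
  have ho1 : o < 1 := ho ▸ sigmoid_lt_one bo
  refine ⟨fun t _ => hcz t, hzM, fun t _ ht => ?_⟩
  rw [hh, hcz, ← one_sub_mul, abs_mul, abs_of_pos (sub_pos.2 ho1)]
  calc (1 - o) * |z t| ≤ (1 - o) * M :=
        mul_le_mul_of_nonneg_left (hzM t ht) (sub_pos.2 ho1).le
    _ < ε := (lt_div_iff₀ hM).1 (by linarith)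
end

section
/- Let a ∈ (0,1), γ > 0, N a positive integer, (X_t)_{t=1}^N a finite real input sequence, z_0 an initial condition, ε > 0, and let M > 0 satisfy |X_t| ≤ M for all t and |z_0| ≤ M, with ε < M. Let (z̃_t)_{t=0}^N be the time-warped system z̃_t = a^γ·z̃_{t-1} + (1-a^γ)·X_t with z̃_0 = z_0. Starting from an LSTM with linear activation constructed with forget gate bias b_f = logit(a), input gate bias b_i = logit(1-a), and output gate o = σ(b_o) with b_o > logit(1 - ε/M), define the modified biases b̃_f = logit(σ(b_f)^γ) and b̃_i = logit(1 - (1 - σ(b_i))^γ). Then the modified LSTM, with cell state c̃_0 = z_0 and c̃_t = σ(b̃_f)·c̃_{t-1} + σ(b̃_i)·X_t and hidden state h̃_t = σ(b_o)·c̃_t, satisfies c̃_t = z̃_t for all t and max_{1 ≤ t ≤ N} |z̃_t - h̃_t| < ε. -/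
theorem sigmoid_strictMono : StrictMono sigmoid := by
  intro x y hxy
  unfold sigmoid
  gcongr

theorem sigmoid_logit {p : ℝ} (hp : 0 < p) (hp1 : p < 1) : sigmoid (logit p) = p := by
  have hq : 0 < 1 - p := sub_pos.mpr hp1
  unfold sigmoid logit
  rw [Real.exp_neg, Real.exp_log (by positivity)]
  field_simp
  ring

/-- A lag system whose input and initial condition are bounded by `M` stays bounded by `M`. -/
theorem abs_timeLag_le {p M : ℝ} (hp : 0 ≤ p) (hp1 : p ≤ 1) {N : ℕ} {X z : ℕ → ℝ}
    (hX : ∀ t : ℕ, 1 ≤ t → t ≤ N → |X t| ≤ M) (hz0 : |z 0| ≤ M)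
    (hz : ∀ t : ℕ, z (t + 1) = p * z t + (1 - p) * X (t + 1)) :
    ∀ t : ℕ, t ≤ N → |z t| ≤ M := by
  intro t
  induction t with
  | zero => exact fun _ => hz0
  | succ t ih =>
    intro ht
    have h := convex_Icc (-M) M (abs_le.mp (ih (by lia)))
      (abs_le.mp (hX (t + 1) (by lia) ht)) hp (sub_nonneg.mpr hp1) (by ring)
    rw [hz]
    exact abs_le.mpr h

/-- Time-warping an LSTM with linear activation: starting from gate biases
`b_f = logit a`, `b_i = logit (1-a)`, `b_o > logit(1 - ε/M)`, the modified biases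
`b̃_f = logit(σ(b_f)^γ)` and `b̃_i = logit(1 - (1 - σ(b_i))^γ)` make the cell state
equal the time-warped system `z̃_t = a^γ z̃_{t-1} + (1 - a^γ) X_t`, and the hidden
state `h̃_t = σ(b_o) c̃_t` approximates it with accuracy `ε`. -/
theorem lstm_timewarp (a γ : ℝ) (ha : 0 < a) (ha1 : a < 1) (hγ : 0 < γ)
    (N : ℕ) (hN : 0 < N) (X : ℕ → ℝ) (z0 ε M : ℝ) (hε : 0 < ε) (hM : 0 < M)
    (hXM : ∀ t : ℕ, 1 ≤ t → t ≤ N → |X t| ≤ M)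
    (hz0M : |z0| ≤ M) (hεM : ε < M)
    (zt : ℕ → ℝ) (hzt0 : zt 0 = z0)
    (hzt : ∀ t : ℕ, zt (t + 1) = a ^ γ * zt t + (1 - a ^ γ) * X (t + 1))
    (bf bi bo : ℝ) (hbf : bf = logit a) (hbi : bi = logit (1 - a))
    (hbo : bo > logit (1 - ε / M))
    (btf bti : ℝ)
    (hbtf : btf = logit ((sigmoid bf) ^ γ))
    (hbti : bti = logit (1 - (1 - sigmoid bi) ^ γ))
    (ct ht : ℕ → ℝ)
    (hct0 : ct 0 = z0)
    (hct : ∀ t : ℕ, ct (t + 1) = sigmoid btf * ct t + sigmoid bti * X (t + 1))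
    (hht : ∀ t : ℕ, ht t = sigmoid bo * ct t) :
    (∀ t : ℕ, t ≤ N → ct t = zt t) ∧
    (∀ t : ℕ, 1 ≤ t → t ≤ N → |zt t - ht t| < ε) := by
  have hp : 0 < a ^ γ := Real.rpow_pos_of_pos ha γ
  have hp1 : a ^ γ < 1 := Real.rpow_lt_one ha.le ha1 hγ
  have hf : sigmoid btf = a ^ γ := by
    rw [hbtf, hbf, sigmoid_logit ha ha1, sigmoid_logit hp hp1]
  have hi : sigmoid bti = 1 - a ^ γ := by
    rw [hbti, hbi, sigmoid_logit (p := 1 - a) (by linarith) (by linarith), sub_sub_cancel,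
      sigmoid_logit (by linarith) (by linarith)]
  have hcell : ∀ t : ℕ, ct t = zt t := by
    intro t
    induction t with
    | zero => rw [hct0, hzt0]
    | succ t ih => rw [hct, hzt, hf, hi, ih]
  refine ⟨fun t _ => hcell t, fun t _ htN => ?_⟩
  have hbound : |zt t| ≤ M :=
    abs_timeLag_le hp.le hp1.le hXM (hzt0 ▸ hz0M) hzt t htN
  have hεM1 : ε / M < 1 := (div_lt_one hM).mpr hεM
  have ho : 1 - ε / M < sigmoid bo := by
    have h := sigmoid_strictMono hbo
    rwa [sigmoid_logit (by linarith) (by linarith [div_pos hε hM])] at h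
  have ho1 : 0 < 1 - sigmoid bo := sub_pos.mpr (sigmoid_lt_one bo)
  calc |zt t - ht t| = (1 - sigmoid bo) * |zt t| := by
        rw [hht, hcell, ← abs_of_pos ho1, ← abs_mul, sub_mul, one_mul]
    _ ≤ (1 - sigmoid bo) * M := by gcongr
    _ < ε := (lt_div_iff₀ hM).mp (by linarith)
end
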